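/- arXiv:2307.09419 — 2 statements merged into one kernel-verified Lean document; each statement's English description precedes it below -/
import Mathlib

section
/- Let ν ≥ 2 be an integer, let j be an integer with 1 ≤ j ≤ ν, and let r be an integer with 0 ≤ r ≤ ν such that either r < j or r = j = ν. Then the double-primed sum Σ''_{k=0}^{ν} β_k^j · V_r(-cos(kπ/ν)) equals (ν / 2^{2j-1}) · [ C(2j-1, j-r-1) + C(2j-1, j-r-2)·δ_{r,ν-1} + C(2j-1, j-r)·δ_{r,ν} ], where C(n,m) denotes the binomial coefficient (taken to be 0 when m < 0) and δ is the Kronecker delta. -/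
open Real

/-- Chebyshev polynomials of the third kind, as functions on ℝ. -/
noncomputable def chebV : ℕ → ℝ → ℝ
  | 0, _ => 1
  | 1, x => 2 * x - 1
  | (n + 2), x => 2 * x * chebV (n + 1) x - chebV n x

/-- Double-primed sum `Σ''_{k=0}^{ν} f k`: first and last terms are halved. -/
noncomputable def dsum (ν : ℕ) (f : ℕ → ℝ) : ℝ :=
  ∑ k ∈ Finset.range (ν + 1), if k = 0 ∨ k = ν then f k / 2 else f k

/-- Binomial coefficient `C(n, m)` for an integer lower index, taken to be 0 for m < 0. -/
noncomputable def binom (n : ℕ) (m : ℤ) : ℝ :=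
  if 0 ≤ m then (n.choose m.toNat : ℝ) else 0

lemma chebV_cos_mul_cos_half (r : ℕ) (φ : ℝ) :
    chebV r (cos φ) * cos (φ / 2) = cos (r * φ + φ / 2) := by
  induction r using Nat.twoStepInduction with
  | zero => simp [chebV]
  | one =>
    obtain ⟨a, rfl⟩ : ∃ a, φ = 2 * a := ⟨φ / 2, by ring⟩
    have h : (1 : ℕ) * (2 * a) + 2 * a / 2 = 3 * a := by push_cast; ring
    rw [h, cos_three_mul, chebV, cos_two_mul, mul_div_cancel_left₀ a two_ne_zero]
    ring
  | more n ih₀ ih₁ =>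
    have h₀ : (n : ℝ) * φ + φ / 2 = ((n + 1 : ℕ) * φ + φ / 2) - φ := by push_cast; ring
    have h₂ : ((n + 2 : ℕ) : ℝ) * φ + φ / 2 = ((n + 1 : ℕ) * φ + φ / 2) + φ := by push_cast; ring
    rw [h₀, cos_sub] at ih₀
    rw [h₂, cos_add, chebV]
    linear_combination 2 * cos φ * ih₁ - ih₀

lemma two_cos_pow_mul_cos (n : ℕ) (a b : ℝ) :
    (2 * cos a) ^ n * cos b =
      ∑ m ∈ Finset.range (n + 1), (n.choose m : ℝ) * cos (b + (n - 2 * m) * a) := by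
  induction n generalizing b with
  | zero => simp
  | succ n ih =>
    have h : (2 * cos a) ^ (n + 1) * cos b =
        (2 * cos a) ^ n * cos (b + a) + (2 * cos a) ^ n * cos (b - a) := by
      rw [cos_add, cos_sub]; ring
    rw [h, ih, ih, Finset.sum_range_succ' _ (n + 1)]
    simp only [Nat.choose_succ_succ, Nat.succ_eq_add_one, Nat.cast_add, add_mul, Finset.sum_add_distrib]
    have h₁ : ∑ m ∈ Finset.range (n + 1), (n.choose m : ℝ) * cos (b + a + (n - 2 * m) * a) =
        ∑ m ∈ Finset.range (n + 1), (n.choose (m + 1) : ℝ) *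
          cos (b + a + (n - 2 * (m + 1 : ℕ)) * a) + cos (b + a + n * a) := by
      have := Finset.sum_range_succ
        (fun m : ℕ => (n.choose m : ℝ) * cos (b + a + (n - 2 * m) * a)) (n + 1)
      rw [Finset.sum_range_succ'] at this
      simpa using this.symm
    rw [h₁, add_comm, add_assoc, add_assoc]
    congr 1
    · refine Finset.sum_congr rfl fun m _ => ?_
      push_cast
      ring_nf
    · congr 1
      · refine Finset.sum_congr rfl fun m _ => ?_
        push_cast
        ring_nf
      · push_cast
        simp
        ring_nf

lemma two_pow_mul_pow_mul_chebV_cos (j r : ℕ) (hj : 1 ≤ j) (φ : ℝ) :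
    2 ^ (2 * j - 1) * (((1 + cos φ) / 2) ^ j * chebV r (cos φ)) =
      ∑ m ∈ Finset.range (2 * j),
        ((2 * j - 1).choose m : ℝ) * cos (((j + r - m : ℤ) : ℝ) * φ) := by
  obtain ⟨i, rfl⟩ : ∃ i, j = i + 1 := ⟨j - 1, by omega⟩
  have hi : 2 * (i + 1) - 1 = 2 * i + 1 := by omega
  have hsq : (1 + cos φ) / 2 = cos (φ / 2) ^ 2 := by rw [cos_sq]; ring_nf
  calc _ = (2 * cos (φ / 2)) ^ (2 * i + 1) * (chebV r (cos φ) * cos (φ / 2)) := by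
        rw [hi, hsq]; ring
    _ = _ := by
        rw [chebV_cos_mul_cos_half, two_cos_pow_mul_cos, hi]
        refine Finset.sum_congr rfl fun m _ => ?_
        push_cast
        ring_nf

lemma dsum_reflect (ν : ℕ) (f : ℕ → ℝ) : dsum ν (fun k => f (ν - k)) = dsum ν f := by
  unfold dsum
  rw [← Finset.sum_range_reflect]
  refine Finset.sum_congr rfl fun k hk => ?_
  have hk : k ≤ ν := by simpa [Nat.lt_succ_iff] using hk
  have h₁ : ν + 1 - 1 - k = ν - k := by omega
  have h₂ : ν - (ν - k) = k := by omega
  have h₃ : (ν - k = 0 ∨ ν - k = ν) ↔ (k = 0 ∨ k = ν) := by omega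
  simp only [h₁, h₂, h₃]

lemma dsum_mul_left (ν : ℕ) (c : ℝ) (f : ℕ → ℝ) :
    dsum ν (fun k => c * f k) = c * dsum ν f := by
  simp only [dsum, Finset.mul_sum, mul_ite, mul_div_assoc]

lemma dsum_sum {ι : Type*} (ν : ℕ) (s : Finset ι) (f : ι → ℕ → ℝ) :
    dsum ν (fun k => ∑ i ∈ s, f i k) = ∑ i ∈ s, dsum ν (f i) := by
  unfold dsum
  rw [Finset.sum_comm]
  refine Finset.sum_congr rfl fun k _ => ?_
  split_ifs
  · rw [Finset.sum_div]
  · rfl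

lemma dsum_eq_sum_sub {ν : ℕ} (hν : 1 ≤ ν) (f : ℕ → ℝ) :
    dsum ν f = ∑ k ∈ Finset.range (ν + 1), f k - (f 0 + f ν) / 2 := by
  obtain ⟨n, rfl⟩ : ∃ n, ν = n + 1 := ⟨ν - 1, by omega⟩
  unfold dsum
  rw [Finset.sum_range_succ, Finset.sum_range_succ', Finset.sum_range_succ,
    Finset.sum_range_succ']
  have h : ∀ k ∈ Finset.range n,
      (if k + 1 = 0 ∨ k + 1 = n + 1 then f (k + 1) / 2 else f (k + 1)) = f (k + 1) := by
    intro k hk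
    have := Finset.mem_range.1 hk
    exact if_neg (by omega)
  rw [Finset.sum_congr rfl h]
  simp
  ring

lemma two_sin_half_mul_sum_cos (n : ℕ) (t : ℝ) :
    2 * sin (t / 2) * ∑ k ∈ Finset.range (n + 1), cos (k * t) =
      sin (n * t + t / 2) + sin (t / 2) := by
  induction n with
  | zero => simp; ring
  | succ n ih =>
    have h₀ : (n : ℝ) * t + t / 2 = (n + 1 : ℕ) * t - t / 2 := by push_cast; ring
    rw [Finset.sum_range_succ, mul_add, ih, h₀, sin_sub, sin_add]
    ring

lemma dsum_cos_of_dvd {ν : ℕ} (hν : 1 ≤ ν) {n : ℤ} (h : (2 * ν : ℤ) ∣ n) :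
    dsum ν (fun k => cos (n * (k * π / ν))) = ν := by
  obtain ⟨q, rfl⟩ := h
  have hν' : (ν : ℝ) ≠ 0 := by positivity
  have h₁ : ∀ k : ℕ, cos (((2 * ν * q : ℤ) : ℝ) * (k * π / ν)) = 1 := by
    intro k
    rw [← cos_int_mul_two_pi (q * k)]
    congr 1
    push_cast
    field_simp
  rw [dsum_eq_sum_sub hν]
  simp [-Int.cast_mul, h₁]

lemma dsum_cos_of_not_dvd {ν : ℕ} (hν : 1 ≤ ν) {n : ℤ} (h : ¬ (2 * ν : ℤ) ∣ n) :
    dsum ν (fun k => cos (n * (k * π / ν))) = 0 := by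
  have hν' : (ν : ℝ) ≠ 0 := by positivity
  set t : ℝ := n * π / ν with ht
  have hsin : sin (t / 2) ≠ 0 := by
    rw [Ne, sin_eq_zero_iff]
    rintro ⟨q, hq⟩
    refine h ⟨q, ?_⟩
    rw [ht] at hq
    field_simp at hq
    have : (n : ℝ) = 2 * ν * q := by linear_combination -hq
    exact_mod_cast this
  have hνt : (ν : ℝ) * t = n * π := by rw [ht]; field_simp
  have hs : ∀ k : ℕ, (n : ℝ) * (k * π / ν) = k * t := fun k => by rw [ht]; ring
  have key := two_sin_half_mul_sum_cos ν t
  rw [sin_add, hνt, sin_int_mul_pi] at key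
  simp only [hs]
  rw [dsum_eq_sum_sub hν]
  refine (mul_eq_zero.1 ?_).resolve_left (mul_ne_zero two_ne_zero hsin)
  rw [mul_sub, key, hνt]
  simp
  ring

lemma dsum_chebV {ν : ℕ} (hν : 1 ≤ ν) (j r : ℕ) (hj : 1 ≤ j) :
    2 ^ (2 * j - 1) * dsum ν (fun k => ((1 - cos (k * π / ν)) / 2) ^ j *
        chebV r (-cos (k * π / ν))) =
      ν * ∑ m ∈ Finset.range (2 * j),
        if (2 * ν : ℤ) ∣ j + r - m then ((2 * j - 1).choose m : ℝ) else 0 := by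
  have hν' : (ν : ℝ) ≠ 0 := by positivity
  have hrefl : dsum ν (fun k => ((1 - cos (k * π / ν)) / 2) ^ j * chebV r (-cos (k * π / ν))) =
      dsum ν (fun k => ((1 + cos (k * π / ν)) / 2) ^ j * chebV r (cos (k * π / ν))) := by
    rw [← dsum_reflect ν fun k => ((1 + cos (k * π / ν)) / 2) ^ j * chebV r (cos (k * π / ν))]
    unfold dsum
    refine Finset.sum_congr rfl fun k hk => ?_
    have hk : k ≤ ν := by simpa [Nat.lt_succ_iff] using hk
    have h : ((ν - k : ℕ) : ℝ) * π / ν = π - k * π / ν := by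
      rw [Nat.cast_sub hk]; field_simp
    simp only [h, cos_pi_sub, ← sub_eq_add_neg]
  rw [hrefl, ← dsum_mul_left]
  simp only [two_pow_mul_pow_mul_chebV_cos j r hj]
  rw [dsum_sum, Finset.mul_sum]
  refine Finset.sum_congr rfl fun m _ => ?_
  rw [dsum_mul_left]
  split_ifs with h
  · rw [dsum_cos_of_dvd hν h, mul_comm]
  · rw [dsum_cos_of_not_dvd hν h, mul_zero, mul_zero]

/-- Lemma 3.2, nonvanishing case: for ν ≥ 2, 1 ≤ j ≤ ν, 0 ≤ r ≤ ν with r < j or r = j = ν,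
`Σ''_{k=0}^{ν} β_k^j V_r(-cos(kπ/ν)) =
 (ν / 2^{2j-1}) [C(2j-1, j-r-1) + C(2j-1, j-r-2) δ_{r,ν-1} + C(2j-1, j-r) δ_{rν}]`,
where `β_k = (1 - cos(kπ/ν))/2`. -/
theorem dsum_eq_binom (ν j r : ℕ) (hν : 2 ≤ ν) (hj1 : 1 ≤ j) (hjν : j ≤ ν)
    (hrν : r ≤ ν) (hcase : r < j ∨ (r = j ∧ j = ν)) :
    dsum ν (fun k => ((1 - Real.cos (k * π / ν)) / 2) ^ j *
        chebV r (-Real.cos (k * π / ν))) =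
      (ν / 2 ^ (2 * j - 1)) *
        (binom (2 * j - 1) ((j : ℤ) - r - 1)
          + binom (2 * j - 1) ((j : ℤ) - r - 2) * (if r = ν - 1 then 1 else 0)
          + binom (2 * j - 1) ((j : ℤ) - r) * (if r = ν then 1 else 0)) := by
  rw [div_mul_eq_mul_div, eq_div_iff (by positivity), mul_comm, dsum_chebV (by omega) j r hj1]
  congr 1
  rcases hcase with hr | ⟨rfl, rfl⟩
  · rw [Finset.sum_eq_single_of_mem (j + r) (Finset.mem_range.2 (by omega))]
    · have h₁ : binom (2 * j - 1) ((j : ℤ) - r - 1) = (2 * j - 1).choose (j + r) := by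
        rw [binom, if_pos (by omega), ← Nat.choose_symm (by omega : j + r ≤ 2 * j - 1)]
        congr 2
        omega
      have h₂ : binom (2 * j - 1) ((j : ℤ) - r - 2) * (if r = ν - 1 then 1 else 0) = 0 := by
        by_cases h : r = ν - 1
        · rw [binom, if_neg (by omega), zero_mul]
        · rw [if_neg h, mul_zero]
      rw [h₁, h₂, if_neg (by omega : ¬ r = ν)]
      simp
    · intro m hm hne
      have hm := Finset.mem_range.1 hm
      refine if_neg fun hdvd => ?_
      have := Int.eq_zero_of_abs_lt_dvd hdvd (abs_lt.2 ⟨by omega, by omega⟩)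
      omega
  · rw [Finset.sum_eq_single_of_mem 0 (Finset.mem_range.2 (by omega))]
    · have h : ¬ r = r - 1 := by omega
      simp [binom, h, two_mul]
    · intro m hm hne
      have hm := Finset.mem_range.1 hm
      refine if_neg fun hdvd => ?_
      have := Int.le_of_dvd (by omega) hdvd
      omega
end

section
/- Let ν ≥ 2 be an integer, h > 0, and for k = 0, ..., ν set β_k = (1 - cos(kπ/ν))/2. For j, k ∈ {0, ..., ν} define c_{jk} = [(1 - cos(kπ/ν)) / (2ν·(1 + δ_{k0} + δ_{kν}))] · Σ_{r=0}^{ν} (-1)^r · I_r(cos(jπ/ν)) · V_r(-cos(kπ/ν)), where δ is the Kronecker delta. Then for every integer n with 0 ≤ n ≤ ν - 2 and every j with 1 ≤ j ≤ ν, Σ_{k=0}^{ν} β_k^n · c_{jk} = ∫_0^{β_j} ln(hΨ)·(β_j - Ψ)^n dΨ. -/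
open Real

/-- Chebyshev polynomials of the fourth kind, as functions on ℝ. -/
noncomputable def chebW : ℕ → ℝ → ℝ
  | 0, _ => 1
  | 1, x => 2 * x + 1
  | (n + 2), x => 2 * x * chebW (n + 1) x - chebW n x

theorem chebV_neg (r : ℕ) (x : ℝ) : chebV r (-x) = (-1) ^ r * chebW r x := by
  induction r using Nat.twoStepInduction with
  | zero => simp [chebV, chebW]
  | one => simp only [chebV, chebW]; ring
  | more r ih₀ ih₁ => simp only [chebV, chebW, ih₀, ih₁]; ring

theorem sin_half_mul_chebW_cos (r : ℕ) (θ : ℝ) :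
    Real.sin (θ / 2) * chebW r (Real.cos θ) = Real.sin ((r + 1 / 2) * θ) := by
  induction r using Nat.twoStepInduction with
  | zero => simp only [chebW, Nat.cast_zero]; ring_nf
  | one =>
    have hsum : ((1 : ℕ) + 1 / 2 : ℝ) * θ = θ + θ / 2 := by push_cast; ring
    have hθ : θ = 2 * (θ / 2) := by ring
    rw [hsum, Real.sin_add]
    have hs : Real.sin θ = 2 * Real.sin (θ / 2) * Real.cos (θ / 2) := by
      rw [← Real.sin_two_mul, ← hθ]
    have hc : Real.cos θ = 2 * Real.cos (θ / 2) ^ 2 - 1 := by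
      rw [← Real.cos_two_mul, ← hθ]
    simp only [chebW]
    rw [hs, hc]
    ring
  | more r ih₀ ih₁ =>
    have h₂ : ((r + 2 : ℕ) + 1 / 2 : ℝ) * θ = ((r + 1 : ℕ) + 1 / 2 : ℝ) * θ + θ := by
      push_cast; ring
    have h₀ : ((r : ℝ) + 1 / 2) * θ = ((r + 1 : ℕ) + 1 / 2 : ℝ) * θ - θ := by
      push_cast; ring
    rw [h₀, Real.sin_sub] at ih₀
    rw [h₂, Real.sin_add]
    simp only [chebW]
    linear_combination 2 * Real.cos θ * ih₁ - ih₀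

theorem one_sub_cos_mul_chebW_mul_chebW (r s : ℕ) (θ : ℝ) :
    (1 - Real.cos θ) * (chebW r (Real.cos θ) * chebW s (Real.cos θ)) =
      Real.cos (((r : ℝ) - s) * θ) - Real.cos (((r : ℝ) + s + 1) * θ) := by
  have hθ : 1 - Real.cos θ = 2 * Real.sin (θ / 2) ^ 2 := by
    have := Real.cos_two_mul (θ / 2)
    rw [mul_div_cancel₀ θ two_ne_zero] at this
    rw [this, Real.cos_sq']
    ring
  have hsub : ((r : ℝ) - s) * θ = (r + 1 / 2) * θ - (s + 1 / 2) * θ := by ring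
  have hadd : ((r : ℝ) + s + 1) * θ = (r + 1 / 2) * θ + (s + 1 / 2) * θ := by ring
  rw [hθ, hsub, hadd, Real.cos_sub, Real.cos_add, ← sin_half_mul_chebW_cos,
    ← sin_half_mul_chebW_cos]
  ring

theorem continuous_chebW (r : ℕ) : Continuous (chebW r) := by
  induction r using Nat.twoStepInduction with
  | zero => exact continuous_const
  | one => exact (continuous_const.mul continuous_id).add continuous_const
  | more r ih₀ ih₁ => exact ((continuous_const.mul continuous_id).mul ih₁).sub ih₀

/-- A sum with halved end terms is a sum of averages of consecutive terms. -/
theorem sum_endpoints_halved (ν : ℕ) (hν : 1 ≤ ν) (g : ℕ → ℝ) :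
    ∑ k ∈ Finset.range (ν + 1),
        g k / (1 + (if k = 0 then (1 : ℝ) else 0) + (if k = ν then (1 : ℝ) else 0)) =
      ∑ k ∈ Finset.range ν, (g k + g (k + 1)) / 2 := by
  obtain ⟨m, rfl⟩ := Nat.exists_eq_add_of_le' hν
  have hinner : ∀ k ∈ Finset.range m, g (k + 1) /
      (1 + (if k + 1 = 0 then (1 : ℝ) else 0) + (if k + 1 = m + 1 then (1 : ℝ) else 0)) =
        g (k + 1) := by
    intro k hk
    have : k ≠ m := (Finset.mem_range.1 hk).ne
    simp [this]
  rw [Finset.sum_range_succ, Finset.sum_range_succ', Finset.sum_congr rfl hinner,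
    ← Finset.sum_div, Finset.sum_add_distrib, Finset.sum_range_succ' g,
    Finset.sum_range_succ (fun k => g (k + 1))]
  simp
  ring

theorem sum_cos_endpoints_halved (ν : ℕ) (hν : 1 ≤ ν) (m : ℤ) (hm : |m| < 2 * ν) :
    ∑ k ∈ Finset.range (ν + 1), Real.cos (m * (k * π / ν)) /
        (1 + (if k = 0 then (1 : ℝ) else 0) + (if k = ν then (1 : ℝ) else 0)) =
      if m = 0 then (ν : ℝ) else 0 := by
  have hν₀ : (ν : ℝ) ≠ 0 := by positivity
  rw [sum_endpoints_halved ν hν fun k : ℕ => Real.cos (m * (k * π / ν))]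
  split_ifs with h₀
  · simp [h₀]
  set φ : ℝ := m * π / ν with hφ
  have hsin : Real.sin (φ / 2) ≠ 0 := by
    rw [Ne, Real.sin_eq_zero_iff]
    rintro ⟨q, hq⟩
    have hqm : m = 2 * ν * q := by
      have : (m : ℝ) = 2 * ν * q := by
        rw [hφ] at hq
        field_simp at hq
        linarith
      exact_mod_cast this
    exact h₀ (Int.eq_zero_of_abs_lt_dvd ⟨q, hqm⟩ hm)
  have hterm : ∀ k ∈ Finset.range ν, Real.sin (φ / 2) *
      ((Real.cos (m * (k * π / ν)) + Real.cos (m * ((k + 1 : ℕ) * π / ν))) / 2) =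
        Real.cos (φ / 2) / 2 * (Real.sin ((k + 1 : ℕ) * φ) - Real.sin (k * φ)) := by
    intro k _
    have e₀ : (m : ℝ) * (k * π / ν) = k * φ := by rw [hφ]; ring
    have e₁ : (m : ℝ) * ((k + 1 : ℕ) * π / ν) = (k + 1 : ℕ) * φ := by rw [hφ]; ring
    rw [e₀, e₁]
    have l : (k : ℝ) * φ = (k + 1 / 2) * φ - φ / 2 := by ring
    have u : ((k + 1 : ℕ) : ℝ) * φ = (k + 1 / 2) * φ + φ / 2 := by push_cast; ring
    rw [l, u, Real.cos_sub, Real.cos_add, Real.sin_sub, Real.sin_add]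
    ring
  refine (mul_eq_zero.1 ?_).resolve_left hsin
  have hend : (ν : ℝ) * φ = m * π := by rw [hφ]; field_simp
  rw [Finset.mul_sum, Finset.sum_congr rfl hterm, ← Finset.mul_sum,
    Finset.sum_range_sub (fun k : ℕ => Real.sin (k * φ)), hend, Real.sin_int_mul_pi]
  simp

/-- Discrete orthogonality of the Chebyshev polynomials of the fourth kind. -/
theorem sum_chebW_mul_chebW (ν r s : ℕ) (hr : r ≤ ν) (hs : s + 1 < ν) :
    ∑ k ∈ Finset.range (ν + 1), (1 - Real.cos (k * π / ν)) *
        (chebW r (Real.cos (k * π / ν)) * chebW s (Real.cos (k * π / ν))) /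
        (1 + (if k = 0 then (1 : ℝ) else 0) + (if k = ν then (1 : ℝ) else 0)) =
      if r = s then (ν : ℝ) else 0 := by
  have hsub := sum_cos_endpoints_halved ν (by lia) ((r : ℤ) - s) (abs_lt.2 ⟨by lia, by lia⟩)
  have hadd := sum_cos_endpoints_halved ν (by lia) ((r : ℤ) + s + 1) (abs_lt.2 ⟨by lia, by lia⟩)
  rw [if_neg (by lia)] at hadd
  push_cast at hsub hadd
  simp only [one_sub_cos_mul_chebW_mul_chebW, sub_div]
  rw [Finset.sum_sub_distrib, hsub, hadd, sub_zero]
  simp only [sub_eq_zero, Nat.cast_inj]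

theorem pow_mem_span_chebW (n : ℕ) :
    (fun x : ℝ => ((1 - x) / 2) ^ n) ∈ Submodule.span ℝ (chebW '' Set.Iic n) := by
  induction n with
  | zero =>
    refine Submodule.subset_span ⟨0, Set.mem_Iic.2 le_rfl, ?_⟩
    funext x
    simp [chebW]
  | succ n ih =>
    have hW : ∀ s ≤ n + 1, chebW s ∈ Submodule.span ℝ (chebW '' Set.Iic (n + 1)) :=
      fun s hs => Submodule.subset_span ⟨s, hs, rfl⟩
    suffices ∀ f ∈ Submodule.span ℝ (chebW '' Set.Iic n),
        (fun x : ℝ => (1 - x) / 2 * f x) ∈ Submodule.span ℝ (chebW '' Set.Iic (n + 1)) by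
      simpa only [pow_succ'] using this _ ih
    intro f hf
    induction hf using Submodule.span_induction with
    | mem f hf =>
      obtain ⟨s, hs, rfl⟩ := hf
      rw [Set.mem_Iic] at hs
      cases s with
      | zero =>
        have : (fun x : ℝ => (1 - x) / 2 * chebW 0 x) =
            (3 / 4 : ℝ) • chebW 0 - (1 / 4 : ℝ) • chebW 1 := by
          funext x
          simp only [chebW, Pi.sub_apply, Pi.smul_apply, smul_eq_mul]
          ring
        rw [this]
        exact sub_mem (Submodule.smul_mem _ _ (hW 0 (by lia)))
          (Submodule.smul_mem _ _ (hW 1 (by lia)))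
      | succ s =>
        have : (fun x : ℝ => (1 - x) / 2 * chebW (s + 1) x) =
            (1 / 2 : ℝ) • chebW (s + 1) - (1 / 4 : ℝ) • (chebW (s + 2) + chebW s) := by
          funext x
          simp only [chebW, Pi.sub_apply, Pi.add_apply, Pi.smul_apply, smul_eq_mul]
          ring
        rw [this]
        exact sub_mem (Submodule.smul_mem _ _ (hW _ (by lia)))
          (Submodule.smul_mem _ _ (add_mem (hW _ (by lia)) (hW _ (by lia))))
    | zero =>
      simp only [Pi.zero_apply, mul_zero]
      exact Submodule.zero_mem _
    | add f g _ _ hf hg =>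
      simp only [Pi.add_apply, mul_add]
      exact add_mem hf hg
    | smul a f _ hf =>
      simp only [Pi.smul_apply, smul_eq_mul, mul_left_comm _ a]
      exact Submodule.smul_mem _ a hf

theorem intervalIntegrable_log_mul (c a b : ℝ) {f : ℝ → ℝ} (hf : Continuous f) :
    IntervalIntegrable (fun t => Real.log (c * t / 2) * f t) MeasureTheory.volume a b := by
  refine IntervalIntegrable.mul_continuousOn ?_ hf.continuousOn
  have := (intervalIntegral.intervalIntegrable_log' (a := c / 2 * a) (b := c / 2 * b)).comp_mul_left
    (c := c / 2)
  rcases eq_or_ne c 0 with rfl | hc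
  · simp
  · simpa [hc, mul_div_right_comm] using this

/-- Equation (36): the logarithmically weighted quadrature rule with weights `c_{jk}`
is exact for polynomials of degree at most ν - 2, i.e. for 0 ≤ n ≤ ν - 2 and
1 ≤ j ≤ ν one has `Σ_{k=0}^{ν} β_k^n c_{jk} = ∫_0^{β_j} ln(hΨ)(β_j - Ψ)^n dΨ`. -/
theorem quadrature_exactness (ν : ℕ) (hν : 2 ≤ ν) (h : ℝ) (hh : 0 < h)
    (β : ℕ → ℝ) (hβ : ∀ k, β k = (1 - Real.cos (k * π / ν)) / 2)
    (I : ℕ → ℝ → ℝ)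
    (hI : ∀ r η, I r η = ∫ t in (0 : ℝ)..(1 - η), Real.log (h * t / 2) * chebW r (t + η))
    (c : ℕ → ℕ → ℝ)
    (hc : ∀ j k, c j k =
      (1 - Real.cos (k * π / ν)) /
          (2 * ν * (1 + (if k = 0 then (1 : ℝ) else 0) + (if k = ν then (1 : ℝ) else 0))) *
        ∑ r ∈ Finset.range (ν + 1),
          (-1) ^ r * I r (Real.cos (j * π / ν)) * chebV r (-Real.cos (k * π / ν)))
    (n j : ℕ) (hn : n ≤ ν - 2) (hj1 : 1 ≤ j) (hjν : j ≤ ν) :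
    ∑ k ∈ Finset.range (ν + 1), (β k) ^ n * c j k =
      ∫ Ψ in (0 : ℝ)..(β j), Real.log (h * Ψ) * (β j - Ψ) ^ n := by
  have hν₀ : (ν : ℝ) ≠ 0 := by positivity
  have hcW : ∀ k, c j k = (1 - Real.cos (k * π / ν)) /
      (2 * ν * (1 + (if k = 0 then (1 : ℝ) else 0) + (if k = ν then (1 : ℝ) else 0))) *
        ∑ r ∈ Finset.range (ν + 1), I r (Real.cos (j * π / ν)) * chebW r (Real.cos (k * π / ν)) := by
    intro k
    rw [hc]
    congr 1
    refine Finset.sum_congr rfl fun r _ => ?_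
    have hsign : ((-1 : ℝ) ^ r) * (-1) ^ r = 1 := by rw [← mul_pow]; simp
    rw [chebV_neg]
    linear_combination
      (I r (Real.cos (j * π / ν)) * chebW r (Real.cos (k * π / ν))) * hsign
  have hrule : ∀ s ≤ n, ∑ k ∈ Finset.range (ν + 1), chebW s (Real.cos (k * π / ν)) * c j k =
      I s (Real.cos (j * π / ν)) / 2 := by
    intro s hs
    calc
      _ = ∑ k ∈ Finset.range (ν + 1), ∑ r ∈ Finset.range (ν + 1),
            I r (Real.cos (j * π / ν)) / (2 * ν) * ((1 - Real.cos (k * π / ν)) *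
              (chebW r (Real.cos (k * π / ν)) * chebW s (Real.cos (k * π / ν))) /
              (1 + (if k = 0 then (1 : ℝ) else 0) + (if k = ν then (1 : ℝ) else 0))) := by
        refine Finset.sum_congr rfl fun k _ => ?_
        rw [hcW, Finset.mul_sum, Finset.mul_sum]
        refine Finset.sum_congr rfl fun r _ => ?_
        simp only [div_eq_mul_inv, mul_inv]
        ring
      _ = ∑ r ∈ Finset.range (ν + 1), I r (Real.cos (j * π / ν)) / (2 * ν) *
            if r = s then (ν : ℝ) else 0 := by
        rw [Finset.sum_comm]
        refine Finset.sum_congr rfl fun r hr => ?_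
        rw [← Finset.mul_sum,
          sum_chebW_mul_chebW ν r s (Nat.lt_succ_iff.1 (Finset.mem_range.1 hr)) (by lia)]
      _ = I s (Real.cos (j * π / ν)) / 2 := by
        simp only [mul_ite, mul_zero]
        rw [Finset.sum_ite_eq' _ _ _, if_pos (Finset.mem_range.2 (by lia))]
        field_simp
  have hspan : ∀ f ∈ Submodule.span ℝ (chebW '' Set.Iic n), Continuous f ∧
      ∑ k ∈ Finset.range (ν + 1), f (Real.cos (k * π / ν)) * c j k =
        (∫ t in (0 : ℝ)..(1 - Real.cos (j * π / ν)),
          Real.log (h * t / 2) * f (t + Real.cos (j * π / ν))) / 2 := by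
    intro f hf
    induction hf using Submodule.span_induction with
    | mem f hf =>
      obtain ⟨s, hs, rfl⟩ := hf
      exact ⟨continuous_chebW s, by rw [hrule s hs, hI]⟩
    | zero => exact ⟨continuous_const, by simp⟩
    | add f g _ _ hf hg =>
      refine ⟨hf.1.add hg.1, ?_⟩
      simp only [Pi.add_apply, add_mul, mul_add]
      rw [Finset.sum_add_distrib, hf.2, hg.2, intervalIntegral.integral_add, add_div]
      · exact intervalIntegrable_log_mul h _ _ (hf.1.comp (continuous_add_const _))
      · exact intervalIntegrable_log_mul h _ _ (hg.1.comp (continuous_add_const _))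
    | smul a f _ hf =>
      refine ⟨hf.1.const_smul a, ?_⟩
      simp only [Pi.smul_apply, smul_eq_mul, mul_left_comm _ a]
      rw [Finset.sum_congr rfl fun k _ => mul_assoc a _ _]
      rw [← Finset.mul_sum, hf.2, intervalIntegral.integral_const_mul, mul_div_assoc a]
  have hpow := (hspan _ (pow_mem_span_chebW n)).2
  simp only [← hβ] at hpow
  rw [hpow]
  have hη : 1 - Real.cos (j * π / ν) = 2 * β j := by rw [hβ]; ring
  have hsubst := intervalIntegral.mul_integral_comp_mul_left (a := 0) (b := β j)
    (f := fun t => Real.log (h * t / 2) * ((1 - (t + Real.cos (j * π / ν))) / 2) ^ n) 2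
  rw [mul_zero, ← hη] at hsubst
  rw [← hsubst, mul_div_cancel_left₀ _ two_ne_zero]
  refine intervalIntegral.integral_congr fun Ψ _ => ?_
  have e₁ : h * (2 * Ψ) / 2 = h * Ψ := by ring
  have e₂ : (1 - (2 * Ψ + Real.cos (j * π / ν))) / 2 = β j - Ψ := by rw [hβ]; ring
  simp only [e₁, e₂]
end
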